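/- arXiv:2012.05213 — 2 statements merged into one kernel-verified Lean document; each statement's English description precedes it below -/
import Mathlib

section
/- Let G = (V,E) be a 3-regular graph. Define a Group-PB instance with unit-cost projects {p_x : x ∈ V}, groups {p_x,p_y} with budget 1 for each edge xy, global budget B = k, and for every edge e = xy two voters, one approving only p_x and one approving only p_y. Then there is a feasible bundle with total approval utility at least 3k if and only if G has an independent set of size k. -/
/-- In a `d`-regular graph, the number of darts with tail in `X` is `d * #X`. -/
theorem SimpleGraph.IsRegularOfDegree.card_filter_dart_fst_mem {V : Type*} [Fintype V]
    [DecidableEq V] {G : SimpleGraph V} [DecidableRel G.Adj] {d : ℕ}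
    (hreg : G.IsRegularOfDegree d) (X : Finset V) :
    (Finset.univ.filter fun e : G.Dart => e.toProd.1 ∈ X).card = d * X.card := by
  rw [Finset.card_eq_sum_card_fiberwise (f := fun e : G.Dart => e.toProd.1) (t := X)
    (fun e he => by simpa using he), mul_comm]
  refine Finset.sum_const_nat fun v hv => ?_
  rw [← hreg.degree_eq v, ← G.dart_fst_fiber_card_eq_degree v, Finset.filter_filter]
  congr 1
  ext e
  simp only [Finset.mem_filter, Finset.mem_univ, true_and]
  exact ⟨fun h => h.2, fun h => ⟨h ▸ hv, h⟩⟩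

/-- For a 3-regular graph: the Group-PB instance with one unit-cost project per vertex,
a budget-1 group per edge, global budget `k`, and for each edge two voters approving
its two endpoints respectively (i.e., one voter per dart, approving the dart's tail),
has a feasible bundle of total approval utility at least `3k` iff the graph has an
independent set of size `k`. -/
theorem stmt_8 {V : Type*} [Fintype V] [DecidableEq V] (G : SimpleGraph V)
    [DecidableRel G.Adj] (hreg : G.IsRegularOfDegree 3) (k : ℕ) :
    (∃ X : Finset V, X.card ≤ k ∧ (∀ x y : V, G.Adj x y → ¬(x ∈ X ∧ y ∈ X)) ∧
      3 * k ≤ (Finset.univ.filter fun d : G.Dart => d.toProd.1 ∈ X).card) ↔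
    (∃ S : Finset V, S.card = k ∧ ∀ x ∈ S, ∀ y ∈ S, ¬ G.Adj x y) := by
  simp only [hreg.card_filter_dart_fst_mem]
  constructor
  · rintro ⟨X, hle, hind, hge⟩
    exact ⟨X, by omega, fun x hx y hy hxy => hind x y hxy ⟨hx, hy⟩⟩
  · rintro ⟨S, rfl, hind⟩
    exact ⟨S, le_rfl, fun x y hxy h => hind x h.1 y h.2 hxy, le_rfl⟩
end

section
/- In the Arc-Supply reduction, for every edge e = (α,β) with supply pairs sorted so that x_1 > x_2 > ... > x_{|L_e|} and y_1 < y_2 < ... < y_{|L_e|}, any feasible solution X to the constructed Utility-Group-PB instance contains exactly one project from F_{e,α} and exactly one project from F_{e,β}. -/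
/-- If every item costs `N` minus a discount and all discounts together stay below `N`,
then a budget of `N` buys at most one item. -/
theorem Finset.card_le_one_of_sum_tsub_le {ι : Type*} [Fintype ι] {N : ℕ} {x : ι → ℕ}
    {s : Finset ι} (hN : ∑ i, x i < N) (hs : ∑ i ∈ s, (N - x i) ≤ N) : s.card ≤ 1 := by
  classical
  rw [Finset.card_le_one]
  intro a ha b hb
  by_contra hab
  have hcost : ∑ i ∈ {a, b}, (N - x i) ≤ ∑ i ∈ s, (N - x i) :=
    Finset.sum_le_sum_of_subset (by grind)
  have hdisc : ∑ i ∈ {a, b}, x i ≤ ∑ i, x i :=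
    Finset.sum_le_sum_of_subset (Finset.subset_univ _)
  rw [Finset.sum_pair hab] at hcost hdisc
  omega

/-- In the Arc-Supply reduction, for an edge with supply list of length `L`
(x-values strictly decreasing, y-values strictly increasing, all positive, `N` large),
any solution respecting the budgets of `F_{e,α}` and `F_{e,β}` (both `N`) and the
utility requirement `L + 1` on `F_e` selects exactly one project from `F_{e,α}` and
exactly one project from `F_{e,β}`. -/
theorem stmt_15 (L N : ℕ) (x y : Fin L → ℕ)
    (hx : ∀ i, 0 < x i) (hy : ∀ i, 0 < y i)
    (hsx : StrictAnti x) (hsy : StrictMono y)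
    (hN : 2 * ∑ i, (x i + y i) < N)
    (Xa Xb : Finset (Fin L))
    (hba : ∑ i ∈ Xa, (N - x i) ≤ N)
    (hbb : ∑ i ∈ Xb, (N - y i) ≤ N)
    (hu : L + 1 ≤ (∑ i ∈ Xa, ((i : ℕ) + 1)) + ∑ i ∈ Xb, (L - (i : ℕ))) :
    Xa.card = 1 ∧ Xb.card = 1 := by
  rw [Finset.sum_add_distrib] at hN
  have ha : Xa.card ≤ 1 := Finset.card_le_one_of_sum_tsub_le (by omega) hba
  have hb : Xb.card ≤ 1 := Finset.card_le_one_of_sum_tsub_le (by omega) hbb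
  have hua : ∑ i ∈ Xa, ((i : ℕ) + 1) ≤ Xa.card * L :=
    Finset.sum_le_card_nsmul _ _ _ fun i _ => i.isLt
  have hub : ∑ i ∈ Xb, (L - (i : ℕ)) ≤ Xb.card * L :=
    Finset.sum_le_card_nsmul _ _ _ fun i _ => Nat.sub_le _ _
  constructor
  · by_contra h
    have h0 : Xa.card = 0 := by omega
    rw [h0] at hua
    have := Nat.mul_le_mul_right L hb
    omega
  · by_contra h
    have h0 : Xb.card = 0 := by omega
    rw [h0] at hub
    have := Nat.mul_le_mul_right L ha
    omega
end
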